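/- arXiv:2404.03163 — 7 statements merged into one kernel-verified Lean document; each statement's English description precedes it below -/
import Mathlib

section
/- Let A be a binary correctness variable and C a calibrated confidence measure. Then for every strictly decreasing function h : ℝ → ℝ, the induced uncertainty measure U_h := h ∘ C is rank-calibrated: any Borel measurable function reg_h : ℝ → ℝ satisfying reg_h(h(c)) = c for all c ∈ [0,1] is a regression function for (A, U_h), and the RCE of U_h computed with reg_h equals 0; concretely, P(U_h ≤ u) = P(reg_h(U_h) ≥ reg_h(u)) for every u in h([0,1]). -/
open MeasureTheory

/-- If `C` is a calibrated confidence measure for a binary correctness variable `A`,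
then for every strictly decreasing `h : ℝ → ℝ` the induced uncertainty measure `U_h := h ∘ C` is
rank-calibrated: any Borel measurable `reg_h` with `reg_h (h c) = c` for all `c ∈ [0,1]` is a
regression function for `(A, U_h)`, the RCE of `U_h` computed with `reg_h` is `0`, and
`P(U_h ≤ u) = P(reg_h (U_h) ≥ reg_h u)` for every `u ∈ h '' [0,1]`. -/
theorem stmt1 {Ω : Type*} [MeasurableSpace Ω] (P : Measure Ω) [IsProbabilityMeasure P]
    (A C : Ω → ℝ) (hA : Measurable A) (hAbin : ∀ ω, A ω = 0 ∨ A ω = 1)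
    (hC : Measurable C) (hC01 : ∀ ω, C ω ∈ Set.Icc (0:ℝ) 1)
    (hcal : C =ᵐ[P] P[A|MeasurableSpace.comap C inferInstance])
    (h : ℝ → ℝ) (hh : StrictAnti h)
    (regh : ℝ → ℝ) (hregh : Measurable regh)
    (hinv : ∀ c ∈ Set.Icc (0:ℝ) 1, regh (h c) = c) :
    ((fun ω => regh (h (C ω)))
        =ᵐ[P] P[A|MeasurableSpace.comap (fun ω => h (C ω)) inferInstance]) ∧
    (∫ u, |((P.map (fun ω => h (C ω))) {u' | regh u ≤ regh u'}).toReal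
        - ((P.map (fun ω => h (C ω))) (Set.Iic u)).toReal|
        ∂(P.map (fun ω => h (C ω))) = 0) ∧
    (∀ u ∈ h '' Set.Icc (0:ℝ) 1,
      P {ω | h (C ω) ≤ u} = P {ω | regh u ≤ regh (h (C ω))}) := by
  have hhm : Measurable h := hh.antitone.measurable
  have hU : Measurable fun ω => h (C ω) := hhm.comp hC
  have hr : ∀ ω, regh (h (C ω)) = C ω := fun ω => hinv _ (hC01 ω)
  have hσ : MeasurableSpace.comap (fun ω => h (C ω)) inferInstance
      = MeasurableSpace.comap C inferInstance := by
    apply le_antisymm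
    · exact (hhm.comp (comap_measurable C)).comap_le
    · have hCm : Measurable[MeasurableSpace.comap (fun ω => h (C ω)) inferInstance] C := by
        simpa only [Function.comp_def, hr] using
          hregh.comp (comap_measurable fun ω => h (C ω))
      exact hCm.comap_le
  have hset : ∀ u ∈ h '' Set.Icc (0:ℝ) 1,
      {ω | h (C ω) ≤ u} = {ω | regh u ≤ regh (h (C ω))} := by
    rintro _ ⟨c, hc, rfl⟩
    ext ω
    simp only [Set.mem_ofPred_eq, hr, hinv c hc, hh.le_iff_ge]
  refine ⟨?_, ?_, fun u hu => by rw [hset u hu]⟩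
  · rw [hσ]
    simpa only [hr] using hcal
  · have himage : ∀ᵐ u ∂(P.map fun ω => h (C ω)),
        regh u ∈ Set.Icc (0:ℝ) 1 ∧ h (regh u) = u := by
      refine (ae_map_iff hU.aemeasurable ((hregh measurableSet_Icc).inter
        (measurableSet_eq_fun (hhm.comp hregh) measurable_id))).2
        (Filter.Eventually.of_forall fun ω => ?_)
      change regh (h (C ω)) ∈ Set.Icc (0:ℝ) 1 ∧ h (regh (h (C ω))) = h (C ω)
      rw [hr]
      exact ⟨hC01 ω, rfl⟩
    refine integral_eq_zero_of_ae ?_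
    filter_upwards [himage] with u hu
    rw [Measure.map_apply hU (measurableSet_le measurable_const hregh),
      Measure.map_apply hU measurableSet_Iic]
    have hpre : (fun ω => h (C ω)) ⁻¹' {u' | regh u ≤ regh u'}
        = (fun ω => h (C ω)) ⁻¹' Set.Iic u := (hset u ⟨regh u, hu.1, hu.2⟩).symm
    simp [hpre]
end

section
/- For any α ∈ (0, 1/2] and β ∈ (0, 1/2], there exist a probability space (Ω, F, P), a binary correctness variable A, a confidence measure C, and a regression function regc for (A, C), such that the confidence RCE of C computed with regc equals α and the ECE of C equals β. -/
open MeasureTheory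

/-- The measure with masses `a`, `b`, `c` at the points `x`, `y`, `z`. -/
noncomputable def threeAtoms {X : Type*} [MeasurableSpace X] (a b c : ℝ) (x y z : X) :
    Measure X :=
  ENNReal.ofReal a • Measure.dirac x + ENNReal.ofReal b • Measure.dirac y
    + ENNReal.ofReal c • Measure.dirac z

section threeAtoms

variable {X : Type*} [MeasurableSpace X] {a b c : ℝ}

theorem isProbabilityMeasure_threeAtoms (ha : 0 ≤ a) (hb : 0 ≤ b) (hc : 0 ≤ c)
    (h : a + b + c = 1) (x y z : X) : IsProbabilityMeasure (threeAtoms a b c x y z) := by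
  constructor
  simp only [threeAtoms, Measure.add_apply, Measure.smul_apply, measure_univ, smul_eq_mul, mul_one]
  rw [← ENNReal.ofReal_add ha hb, ← ENNReal.ofReal_add (add_nonneg ha hb) hc, h,
    ENNReal.ofReal_one]

theorem map_threeAtoms {Y : Type*} [MeasurableSpace Y] {f : X → Y} (hf : Measurable f)
    (x y z : X) : (threeAtoms a b c x y z).map f = threeAtoms a b c (f x) (f y) (f z) := by
  simp only [threeAtoms, Measure.map_add _ _ hf, Measure.map_smul, Measure.map_dirac' hf]

variable [MeasurableSingletonClass X]

theorem integrable_threeAtoms (x y z : X) (f : X → ℝ) :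
    Integrable f (threeAtoms a b c x y z) :=
  (((integrable_dirac (by simp)).smul_measure ENNReal.ofReal_ne_top).add_measure
    ((integrable_dirac (by simp)).smul_measure ENNReal.ofReal_ne_top)).add_measure
    ((integrable_dirac (by simp)).smul_measure ENNReal.ofReal_ne_top)

theorem integral_threeAtoms (ha : 0 ≤ a) (hb : 0 ≤ b) (hc : 0 ≤ c) (x y z : X) (f : X → ℝ) :
    ∫ t, f t ∂(threeAtoms a b c x y z) = a * f x + b * f y + c * f z := by
  have h (r : ℝ) (w : X) : Integrable f (ENNReal.ofReal r • Measure.dirac w) :=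
    (integrable_dirac (by simp)).smul_measure ENNReal.ofReal_ne_top
  rw [threeAtoms, integral_add_measure ((h _ _).add_measure (h _ _)) (h _ _),
    integral_add_measure (h _ _) (h _ _)]
  simp [integral_smul_measure, ENNReal.toReal_ofReal, ha, hb, hc]

theorem toReal_threeAtoms_apply (ha : 0 ≤ a) (hb : 0 ≤ b) (hc : 0 ≤ c) (x y z : X) {s : Set X}
    (hs : MeasurableSet s) :
    (threeAtoms a b c x y z s).toReal
      = a * s.indicator 1 x + b * s.indicator 1 y + c * s.indicator 1 z := by
  rw [← integral_threeAtoms ha hb hc, integral_indicator_one hs, Measure.real]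

end threeAtoms

/-- For any `α, β ∈ (0, 1/2]` there exist a probability space, a binary
correctness variable `A`, a confidence measure `C`, and a regression function `regc` for
`(A, C)`, such that the confidence RCE of `C` computed with `regc` equals `α` and the ECE of
`C` equals `β`. -/
theorem stmt2 (α β : ℝ) (hα : α ∈ Set.Ioc (0:ℝ) (1/2)) (hβ : β ∈ Set.Ioc (0:ℝ) (1/2)) :
    ∃ (Ω : Type) (_ : MeasurableSpace Ω) (P : Measure Ω) (_ : IsProbabilityMeasure P)
      (A C : Ω → ℝ) (regc : ℝ → ℝ),
      Measurable A ∧ (∀ ω, A ω = 0 ∨ A ω = 1) ∧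
      Measurable C ∧ (∀ ω, C ω ∈ Set.Icc (0:ℝ) 1) ∧
      Measurable regc ∧
      ((fun ω => regc (C ω)) =ᵐ[P] P[A|MeasurableSpace.comap C inferInstance]) ∧
      (∫ c, |((P.map C) {c' | regc c ≤ regc c'}).toReal
          - ((P.map C) (Set.Ici c)).toReal| ∂(P.map C) = α) ∧
      (∫ ω, |(P[A|MeasurableSpace.comap C inferInstance]) ω - C ω| ∂P = β) := by
  obtain ⟨hα0, hα1⟩ := hα
  obtain ⟨hβ0, hβ1⟩ := hβ
  obtain ⟨p, hp0, hp1, hp⟩ : ∃ p : ℝ, 0 ≤ p ∧ p ≤ 1 ∧ 2 * p * (1 - p) = α := by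
    have hs : Real.sqrt (1 - 2 * α) ^ 2 = 1 - 2 * α := Real.sq_sqrt (by linarith)
    have hs0 := Real.sqrt_nonneg (1 - 2 * α)
    exact ⟨(1 - Real.sqrt (1 - 2 * α)) / 2, by nlinarith, by linarith, by linear_combination -hs / 2⟩
  have ha : 0 ≤ (1 - p) * β := mul_nonneg (by linarith) hβ0.le
  have hb : 0 ≤ (1 - p) * (1 - β) := mul_nonneg (by linarith) (by linarith)
  let A : Fin 3 → ℝ := ![1, 0, 0]
  let C : Fin 3 → ℝ := ![0, 0, β]
  let P : Measure (Fin 3) := threeAtoms ((1 - p) * β) ((1 - p) * (1 - β)) p 0 1 2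
  have hP : IsProbabilityMeasure P := isProbabilityMeasure_threeAtoms ha hb hp0 (by ring) _ _ _
  have hC : Measurable C := measurable_of_finite C
  have hmap : P.map C = threeAtoms ((1 - p) * β) ((1 - p) * (1 - β)) p 0 0 β :=
    map_threeAtoms hC _ _ _
  have hreg : (fun ω => β - C ω) =ᵐ[P] P[A|MeasurableSpace.comap C inferInstance] := by
    refine ae_eq_condExp_of_forall_setIntegral_eq hC.comap_le (integrable_threeAtoms _ _ _ _)
      (fun _ _ _ => (integrable_threeAtoms _ _ _ _).integrableOn) ?_ ?_
    · rintro _ ⟨t, ht, rfl⟩ -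
      rw [← integral_indicator (hC ht), ← integral_indicator (hC ht),
        integral_threeAtoms ha hb hp0, integral_threeAtoms ha hb hp0]
      have hC0 : C 0 = 0 := rfl
      have hC1 : C 1 = 0 := rfl
      have hC2 : C 2 = β := rfl
      have hA0 : A 0 = 1 := rfl
      have hA1 : A 1 = 0 := rfl
      have hA2 : A 2 = 0 := rfl
      classical
      simp only [Set.indicator_apply, Set.mem_preimage, hC0, hC1, hC2, hA0, hA1, hA2]
      split_ifs <;> ring
    · exact (measurable_const.sub (comap_measurable C)).stronglyMeasurable.aestronglyMeasurable
  refine ⟨Fin 3, inferInstance, P, hP, A, C, fun c => β - c, measurable_of_finite A, ?_, hC, ?_,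
    measurable_const.sub measurable_id, hreg, ?_, ?_⟩
  · intro ω
    fin_cases ω <;> simp [A]
  · intro ω
    fin_cases ω <;> simp [C] <;> constructor <;> linarith
  · have hset (c : ℝ) : {c' : ℝ | β - c ≤ β - c'} = Set.Iic c := by
      ext c'
      exact sub_le_sub_iff_left β
    simp only [hset, hmap]
    rw [integral_threeAtoms ha hb hp0]
    simp only [toReal_threeAtoms_apply ha hb hp0 _ _ _ measurableSet_Iic,
      toReal_threeAtoms_apply ha hb hp0 _ _ _ measurableSet_Ici, Set.indicator_apply,
      Set.mem_Iic, Set.mem_Ici, le_refl, hβ0.le, hβ0.not_ge, if_true, if_false, Pi.one_apply]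
    rw [abs_of_nonpos (by linarith), abs_of_nonneg (by linarith)]
    linear_combination hp
  · rw [integral_congr_ae (g := fun _ => β)]
    · simp
    · filter_upwards [hreg] with ω hω
      rw [← hω]
      fin_cases ω <;> simp [C, abs_of_pos hβ0]
end

section
/- Let A be a binary correctness variable and U an uncertainty measure with regression function reg taking values in [0,1]. If reg is strictly decreasing, then the confidence measure C := reg ∘ U is calibrated, i.e., E[A | σ(reg ∘ U)] = reg ∘ U P-almost surely. -/
open MeasureTheory

/-- If the regression function `reg` of an uncertainty measure `U` (for a binary
correctness variable `A`) takes values in `[0,1]` and is strictly decreasing, then the confidence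
measure `C := reg ∘ U` is calibrated: `E[A | σ(reg ∘ U)] = reg ∘ U` `P`-a.s. -/
theorem stmt4 {Ω : Type*} [MeasurableSpace Ω] (P : Measure Ω) [IsProbabilityMeasure P]
    (A U : Ω → ℝ) (hA : Measurable A) (hAbin : ∀ ω, A ω = 0 ∨ A ω = 1)
    (hU : Measurable U) (reg : ℝ → ℝ) (hreg : Measurable reg)
    (hreg01 : ∀ x, reg x ∈ Set.Icc (0:ℝ) 1)
    (hver : (fun ω => reg (U ω)) =ᵐ[P] P[A|MeasurableSpace.comap U inferInstance])
    (hanti : StrictAnti reg) :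
    (fun ω => reg (U ω))
      =ᵐ[P] P[A|MeasurableSpace.comap (fun ω => reg (U ω)) inferInstance] := by
  have hC : Measurable fun ω => reg (U ω) := hreg.comp hU
  have hCU : MeasurableSpace.comap (fun ω => reg (U ω)) inferInstance
      ≤ MeasurableSpace.comap U inferInstance :=
    (hreg.comp (comap_measurable U)).comap_le
  have hint : Integrable (fun ω => reg (U ω)) P := integrable_condExp.congr hver.symm
  have hself : P[fun ω => reg (U ω)|MeasurableSpace.comap (fun ω => reg (U ω)) inferInstance]
      = fun ω => reg (U ω) :=
    condExp_of_stronglyMeasurable hC.comap_le (comap_measurable _).stronglyMeasurable hint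
  calc (fun ω => reg (U ω))
      = P[fun ω => reg (U ω)|MeasurableSpace.comap (fun ω => reg (U ω)) inferInstance] :=
        hself.symm
    _ =ᵐ[P] P[P[A|MeasurableSpace.comap U inferInstance]|
          MeasurableSpace.comap (fun ω => reg (U ω)) inferInstance] := condExp_congr_ae hver
    _ =ᵐ[P] P[A|MeasurableSpace.comap (fun ω => reg (U ω)) inferInstance] :=
        condExp_condExp_of_le hCU hU.comap_le
end

section
/- Let A be a binary correctness variable and C a confidence measure such that A and C are independent. Then the constant function regc ≡ E[A] is a regression function for (A, C), and the confidence RCE of C computed with this regc equals (1 − ∫ ν({c}) dν(c))/2, where ν is the distribution of C; equivalently, it equals P(C' < C) where C' is an independent copy of C. -/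
open MeasureTheory

/-- For an s-finite measure on the reals, `P(Y < X) = P(X < Y)` for independent copies. -/
theorem lintegral_measure_Iio_eq_lintegral_measure_Ioi (ν : Measure ℝ) [SFinite ν] :
    ∫⁻ c, ν (Set.Iio c) ∂ν = ∫⁻ c, ν (Set.Ioi c) ∂ν := by
  have hs : MeasurableSet {p : ℝ × ℝ | p.2 < p.1} :=
    measurableSet_lt measurable_snd measurable_fst
  exact (Measure.prod_apply hs).symm.trans (Measure.prod_apply_symm hs)

theorem measurable_measure_singleton (ν : Measure ℝ) [SFinite ν] :
    Measurable fun c => ν {c} := by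
  have hs : MeasurableSet {p : ℝ × ℝ | p.2 = p.1} :=
    measurableSet_eq_fun measurable_snd measurable_fst
  exact measurable_measure_prodMk_left hs

theorem measurable_measure_Iio (ν : Measure ℝ) : Measurable fun c => ν (Set.Iio c) :=
  Monotone.measurable fun _ _ h => measure_mono (Set.Iio_subset_Iio h)

theorem measurable_measure_Ioi (ν : Measure ℝ) : Measurable fun c => ν (Set.Ioi c) :=
  Antitone.measurable fun _ _ h => measure_mono (Set.Ioi_subset_Ioi h)

theorem integral_measureReal_Iio_eq_integral_measureReal_Ioi (ν : Measure ℝ)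
    [IsFiniteMeasure ν] :
    ∫ c, ν.real (Set.Iio c) ∂ν = ∫ c, ν.real (Set.Ioi c) ∂ν := by
  simp only [measureReal_def]
  rw [integral_toReal (measurable_measure_Iio ν).aemeasurable
      (Filter.Eventually.of_forall fun _ => measure_lt_top _ _),
    integral_toReal (measurable_measure_Ioi ν).aemeasurable
      (Filter.Eventually.of_forall fun _ => measure_lt_top _ _),
    lintegral_measure_Iio_eq_lintegral_measure_Ioi]

theorem measureReal_Iio_eq_one_sub (ν : Measure ℝ) [IsProbabilityMeasure ν] (c : ℝ) :
    ν.real (Set.Iio c) = 1 - ν.real (Set.Ici c) := by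
  rw [← Set.compl_Ici, probReal_compl_eq_one_sub measurableSet_Ici]

theorem integral_measureReal_Iio (ν : Measure ℝ) [IsProbabilityMeasure ν] :
    ∫ c, ν.real (Set.Iio c) ∂ν = (1 - ∫ c, ν.real {c} ∂ν) / 2 := by
  have integrable_of {s : ℝ → Set ℝ} (hs : Measurable fun c => ν (s c)) :
      Integrable (fun c => ν.real (s c)) ν :=
    Integrable.of_bound hs.ennreal_toReal.aestronglyMeasurable 1
      (Filter.Eventually.of_forall fun c => by
        simp [Real.norm_eq_abs, abs_of_nonneg measureReal_nonneg])
  have hsplit (c : ℝ) : ν.real (Set.Ioi c) = 1 - ν.real (Set.Iio c) - ν.real {c} := by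
    have h : ν.real (Set.Ici c) = ν.real (Set.Ioi c) + ν.real {c} := by
      rw [← Set.Ioi_union_left, measureReal_union (by simp) (measurableSet_singleton c)]
    linarith [measureReal_Iio_eq_one_sub ν c]
  have hIio := integrable_of (measurable_measure_Iio ν)
  have h := integral_measureReal_Iio_eq_integral_measureReal_Ioi ν
  simp only [hsplit] at h
  have hsub : Integrable (fun c => 1 - ν.real (Set.Iio c)) ν := (integrable_const _).sub hIio
  rw [integral_sub hsub
      (integrable_of (measurable_measure_singleton ν)),
    integral_sub (integrable_const _) hIio] at h
  simp only [integral_const, probReal_univ, smul_eq_mul, mul_one] at h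
  linarith

/-- If a binary correctness variable `A` and a confidence measure `C` are
independent, then the constant function `regc ≡ E[A]` is a regression function for `(A, C)`, and
the confidence RCE of `C` computed with this `regc` equals `(1 − ∫ ν({c}) dν(c))/2`, where `ν` is
the distribution of `C`; equivalently, it equals `P(C' < C)` for `C'` an independent copy of `C`,
i.e. `∫ ν((−∞, c)) dν(c)`. -/
theorem stmt6 {Ω : Type*} [MeasurableSpace Ω] (P : Measure Ω) [IsProbabilityMeasure P]
    (A C : Ω → ℝ) (hA : Measurable A) (hAbin : ∀ ω, A ω = 0 ∨ A ω = 1)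
    (hC : Measurable C) (hC01 : ∀ ω, C ω ∈ Set.Icc (0:ℝ) 1)
    (hindep : ProbabilityTheory.IndepFun A C P) :
    ((fun _ : Ω => ∫ ω, A ω ∂P) =ᵐ[P] P[A|MeasurableSpace.comap C inferInstance]) ∧
    (∫ c, |((P.map C) {c' | (∫ ω, A ω ∂P) ≤ (∫ ω, A ω ∂P)}).toReal
        - ((P.map C) (Set.Ici c)).toReal| ∂(P.map C)
      = (1 - ∫ c, ((P.map C) {c}).toReal ∂(P.map C)) / 2) ∧
    (∫ c, |((P.map C) {c' | (∫ ω, A ω ∂P) ≤ (∫ ω, A ω ∂P)}).toReal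
        - ((P.map C) (Set.Ici c)).toReal| ∂(P.map C)
      = ∫ c, ((P.map C) (Set.Iio c)).toReal ∂(P.map C)) := by
  have : IsProbabilityMeasure (P.map C) := Measure.isProbabilityMeasure_map hC.aemeasurable
  have hRCE : ∫ c, |((P.map C) {c' | (∫ ω, A ω ∂P) ≤ (∫ ω, A ω ∂P)}).toReal
        - ((P.map C) (Set.Ici c)).toReal| ∂(P.map C)
      = ∫ c, ((P.map C) (Set.Iio c)).toReal ∂(P.map C) := by
    refine integral_congr_ae (Filter.Eventually.of_forall fun c => ?_)
    have h := measureReal_Iio_eq_one_sub (P.map C) c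
    simp only [measureReal_def] at h
    simp only [le_refl, Set.ofPred_true, measure_univ, ENNReal.toReal_one, ← h]
    exact abs_of_nonneg ENNReal.toReal_nonneg
  refine ⟨?_, hRCE.trans (integral_measureReal_Iio _), hRCE⟩
  exact (condExp_indep_eq hA.comap_le hC.comap_le
    (comap_measurable A).stronglyMeasurable hindep).symm
end

section
/- Fix β ∈ (0, 1/2]. Let C be a confidence measure whose distribution is the uniform distribution on the interval [1/2 − β, 1/2 + β], and let A be a binary correctness variable independent of C with P(A = 1) = 1/2 + β. Then the constant function regc ≡ 1/2 + β is a regression function for (A, C), and the confidence RCE of C computed with this regc equals 1/2. -/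
open MeasureTheory ProbabilityTheory

theorem cond_volume_Icc_Ici_toReal {a b c : ℝ} (hab : a < b) (hc : c ∈ Set.Icc a b) :
    (ProbabilityTheory.cond volume (Set.Icc a b) (Set.Ici c)).toReal = (b - c) / (b - a) := by
  have hinter : Set.Icc a b ∩ Set.Ici c = Set.Icc c b := by
    ext x
    exact ⟨fun h => ⟨h.2, h.1.2⟩, fun h => ⟨⟨hc.1.trans h.1, h.2⟩, h.1⟩⟩
  rw [cond_apply measurableSet_Icc, hinter, Real.volume_Icc, Real.volume_Icc, ENNReal.toReal_mul,
    ENNReal.toReal_inv, ENNReal.toReal_ofReal (sub_nonneg.2 hab.le),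
    ENNReal.toReal_ofReal (sub_nonneg.2 hc.2), div_eq_inv_mul]

theorem integral_abs_one_sub_cond_volume_Icc_Ici {a b : ℝ} (hab : a < b) :
    ∫ c, |1 - (ProbabilityTheory.cond volume (Set.Icc a b) (Set.Ici c)).toReal|
      ∂(ProbabilityTheory.cond volume (Set.Icc a b)) = 1 / 2 := by
  have hpos : 0 < b - a := sub_pos.2 hab
  have hcongr : ∫ c in Set.Icc a b,
      |1 - (ProbabilityTheory.cond volume (Set.Icc a b) (Set.Ici c)).toReal|
      = ∫ c in Set.Icc a b, (c - a) / (b - a) := by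
    refine setIntegral_congr_fun measurableSet_Icc fun c hc => ?_
    have h : 1 - (b - c) / (b - a) = (c - a) / (b - a) := by
      field_simp
      ring
    simp only [cond_volume_Icc_Ici_toReal hab hc, h]
    exact abs_of_nonneg (div_nonneg (sub_nonneg.2 hc.1) hpos.le)
  conv_lhs => rw [ProbabilityTheory.cond]
  rw [integral_smul_measure]
  change _ • ∫ c in Set.Icc a b,
    |1 - (ProbabilityTheory.cond volume (Set.Icc a b) (Set.Ici c)).toReal| = _
  rw [hcongr, integral_Icc_eq_integral_Ioc, ← intervalIntegral.integral_of_le hab.le,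
    intervalIntegral.integral_div,
    intervalIntegral.integral_sub (by simp) (by simp), integral_id,
    intervalIntegral.integral_const, Real.volume_Icc, ENNReal.toReal_inv,
    ENNReal.toReal_ofReal hpos.le, smul_eq_mul, smul_eq_mul]
  field_simp
  ring

theorem integral_eq_measureReal_of_binary {Ω : Type*} [MeasurableSpace Ω] (P : Measure Ω)
    {A : Ω → ℝ} (hA : Measurable A) (hAbin : ∀ ω, A ω = 0 ∨ A ω = 1) :
    ∫ ω, A ω ∂P = P.real {ω | A ω = 1} := by
  have hind : A = {ω | A ω = 1}.indicator 1 := by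
    ext ω
    rcases hAbin ω with h | h <;> simp [Set.indicator, h]
  conv_lhs => rw [hind]
  exact integral_indicator_one (hA (measurableSet_singleton 1))

/-- Fix `β ∈ (0, 1/2]`. If the distribution of the confidence measure `C` is the
uniform distribution on `[1/2 − β, 1/2 + β]` and `A` is a binary correctness variable independent
of `C` with `P(A = 1) = 1/2 + β`, then the constant function `regc ≡ 1/2 + β` is a regression
function for `(A, C)`, and the confidence RCE of `C` computed with this `regc` equals `1/2`. -/
theorem stmt7 {Ω : Type*} [MeasurableSpace Ω] (P : Measure Ω) [IsProbabilityMeasure P]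
    (β : ℝ) (hβ : β ∈ Set.Ioc (0:ℝ) (1/2))
    (A C : Ω → ℝ) (hA : Measurable A) (hAbin : ∀ ω, A ω = 0 ∨ A ω = 1)
    (hC : Measurable C) (hC01 : ∀ ω, C ω ∈ Set.Icc (0:ℝ) 1)
    (hCdist : P.map C = ProbabilityTheory.cond volume (Set.Icc (1/2 - β) (1/2 + β)))
    (hindep : ProbabilityTheory.IndepFun A C P)
    (hA1 : P {ω | A ω = 1} = ENNReal.ofReal (1/2 + β)) :
    ((fun _ : Ω => 1/2 + β) =ᵐ[P] P[A|MeasurableSpace.comap C inferInstance]) ∧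
    (∫ c, |((P.map C) {c' | (1/2 + β : ℝ) ≤ (1/2 + β : ℝ)}).toReal
        - ((P.map C) (Set.Ici c)).toReal| ∂(P.map C) = 1/2) := by
  obtain ⟨hβ0, hβ1⟩ := hβ
  constructor
  · have hcond := condExp_indep_eq hA.comap_le hC.comap_le
      (comap_measurable A).stronglyMeasurable hindep
    have hmean : ∫ ω, A ω ∂P = 1 / 2 + β := by
      rw [integral_eq_measureReal_of_binary P hA hAbin, Measure.real, hA1,
        ENNReal.toReal_ofReal (by linarith)]
    rw [hmean] at hcond
    exact hcond.symm
  · have : IsProbabilityMeasure (P.map C) := Measure.isProbabilityMeasure_map hC.aemeasurable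
    simp only [le_refl, Set.ofPred_true, measure_univ, ENNReal.toReal_one]
    rw [hCdist]
    exact integral_abs_one_sub_cond_volume_Icc_Ici (by linarith)
end

section
/- Let C be a confidence measure taking K distinct values c₁, …, c_K ∈ [0,1] with probabilities p₁, …, p_K (so Σ p_k = 1), and let A be a binary correctness variable independent of C. Then the constant function regc ≡ E[A] is a regression function for (A, C), and the confidence RCE of C computed with this regc equals (1 − Σ_{k=1}^K p_k²)/2. -/
open MeasureTheory

/-- The law of a random variable with finitely many values integrates functions as a weighted sum
over these values. -/
lemma integral_map_eq_sum_of_finite_values {Ω ι : Type*} [Fintype ι] [MeasurableSpace Ω]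
    (P : Measure Ω) [IsProbabilityMeasure P] {C : Ω → ℝ} (hC : Measurable C) {c : ι → ℝ}
    (hcinj : Function.Injective c) (hvals : ∀ ω, ∃ k, C ω = c k) {p : ι → ℝ} (hp : ∀ k, 0 ≤ p k)
    (hprob : ∀ k, P {ω | C ω = c k} = ENNReal.ofReal (p k)) (g : ℝ → ℝ) :
    ∫ x, g x ∂(P.map C) = ∑ k, p k * g (c k) := by
  let _ : MeasurableSpace ι := ⊤
  choose κ hκ using hvals
  have hpre (k : ι) : κ ⁻¹' {k} = {ω | C ω = c k} := by
    ext ω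
    simp [hκ, hcinj.eq_iff]
  have hκm : Measurable κ := measurable_to_countable' fun k => by
    rw [hpre]
    exact hC (measurableSet_singleton _)
  have hcm : MeasurableEmbedding c :=
    ⟨hcinj, measurable_from_top, fun s _ => (s.toFinite.image c).measurableSet⟩
  have hmap : P.map C = (P.map κ).map c := by
    rw [Measure.map_map hcm.measurable hκm]
    exact congrArg (P.map ·) (funext hκ)
  have : IsProbabilityMeasure (P.map κ) := Measure.isProbabilityMeasure_map hκm.aemeasurable
  rw [hmap, hcm.integral_map, integral_fintype .of_finite]
  refine Finset.sum_congr rfl fun k _ => ?_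
  rw [map_measureReal_apply hκm (measurableSet_singleton k), hpre, measureReal_def, hprob,
    ENNReal.toReal_ofReal (hp k), smul_eq_mul]

/-- The probability that two independent draws from a distribution `p` are strictly ordered. -/
lemma sum_mul_sum_ite_lt {ι : Type*} [Fintype ι] {c : ι → ℝ} (hcinj : Function.Injective c)
    {p : ι → ℝ} (hpsum : ∑ k, p k = 1) :
    ∑ k, p k * ∑ j, p j * (if c j < c k then 1 else 0) = (1 - ∑ k, (p k) ^ 2) / 2 := by
  classical
  set S := ∑ k, p k * ∑ j, p j * (if c j < c k then (1 : ℝ) else 0) with hS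
  have hS' : S = ∑ k, ∑ j, p k * (p j * (if c k < c j then (1 : ℝ) else 0)) := by
    simp_rw [hS, Finset.mul_sum]
    rw [Finset.sum_comm]
    exact Finset.sum_congr rfl fun k _ => Finset.sum_congr rfl fun j _ => by ring
  have hdiag : ∑ k, (p k) ^ 2 = ∑ k, ∑ j, p k * (p j * (if k = j then (1 : ℝ) else 0)) := by
    simp [sq]
  have hone : (1 : ℝ) = ∑ k, ∑ j, p k * p j := by
    rw [← Finset.sum_mul_sum, hpsum, one_mul]
  have htotal : S + S + ∑ k, (p k) ^ 2 = ∑ k, ∑ j, p k * p j := by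
    nth_rewrite 2 [hS']
    rw [hdiag, hS]
    simp_rw [Finset.mul_sum, ← Finset.sum_add_distrib]
    refine Finset.sum_congr rfl fun k _ => Finset.sum_congr rfl fun j _ => ?_
    rcases lt_trichotomy (c j) (c k) with h | h | h
    · have hne : k ≠ j := by rintro rfl; exact h.false
      simp [h, h.not_gt, hne]
    · obtain rfl := hcinj h
      simp
    · have hne : k ≠ j := by rintro rfl; exact h.false
      simp [h, h.not_gt, hne]
  linarith

/-- If a confidence measure `C` takes `K` distinct values `c₁, …, c_K ∈ [0,1]`
with probabilities `p₁, …, p_K` (summing to `1`), and `A` is a binary correctness variable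
independent of `C`, then the constant function `regc ≡ E[A]` is a regression function for
`(A, C)` and the confidence RCE of `C` computed with this `regc` equals `(1 − Σ p_k²)/2`. -/
theorem stmt11 {Ω : Type*} [MeasurableSpace Ω] (P : Measure Ω) [IsProbabilityMeasure P]
    (A C : Ω → ℝ) (hA : Measurable A) (hAbin : ∀ ω, A ω = 0 ∨ A ω = 1)
    (hC : Measurable C) (hC01 : ∀ ω, C ω ∈ Set.Icc (0:ℝ) 1)
    (hindep : ProbabilityTheory.IndepFun A C P)
    (K : ℕ) (hK : 1 ≤ K) (c : Fin K → ℝ) (hcinj : Function.Injective c)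
    (hc01 : ∀ k, c k ∈ Set.Icc (0:ℝ) 1)
    (hvals : ∀ ω, ∃ k, C ω = c k)
    (p : Fin K → ℝ) (hp : ∀ k, 0 ≤ p k) (hpsum : ∑ k, p k = 1)
    (hprob : ∀ k, P {ω | C ω = c k} = ENNReal.ofReal (p k)) :
    ((fun _ : Ω => ∫ ω, A ω ∂P) =ᵐ[P] P[A|MeasurableSpace.comap C inferInstance]) ∧
    (∫ x, |((P.map C) {c' | (∫ ω, A ω ∂P) ≤ (∫ ω, A ω ∂P)}).toReal
        - ((P.map C) (Set.Ici x)).toReal| ∂(P.map C)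
      = (1 - ∑ k, (p k) ^ 2) / 2) := by
  refine ⟨(condExp_indep_eq hA.comap_le hC.comap_le
    (comap_measurable A).stronglyMeasurable hindep).symm, ?_⟩
  have hprobm : IsProbabilityMeasure (P.map C) := Measure.isProbabilityMeasure_map hC.aemeasurable
  have hint := integral_map_eq_sum_of_finite_values P hC hcinj hvals hp hprob
  have habs (x : ℝ) : |((P.map C) {c' | (∫ ω, A ω ∂P) ≤ (∫ ω, A ω ∂P)}).toReal
      - ((P.map C) (Set.Ici x)).toReal| = ∑ j, p j * (if c j < x then 1 else 0) := by
    have hIio : ((P.map C) {c' | (∫ ω, A ω ∂P) ≤ (∫ ω, A ω ∂P)}).toReal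
        - ((P.map C) (Set.Ici x)).toReal = (P.map C).real (Set.Iio x) := by
      rw [← Set.compl_Ici, probReal_compl_eq_one_sub measurableSet_Ici]
      simp [measureReal_def]
    rw [hIio, abs_of_nonneg measureReal_nonneg, ← integral_indicator_one measurableSet_Iio, hint]
    simp [Set.indicator_apply]
  simp_rw [habs]
  rw [hint, sum_mul_sum_ite_lt hcinj hpsum]
end

section
/- Let A be a binary correctness variable, U an uncertainty measure with regression function reg, and h : ℝ → ℝ a strictly increasing function. Let reg_h : ℝ → ℝ be any Borel measurable function with reg_h(h(u)) = reg(u) for all u ∈ ℝ. Then reg_h is a regression function for (A, h ∘ U), and the RCE of h ∘ U computed with reg_h equals the RCE of U computed with reg; in particular, if U is rank-calibrated then so is h ∘ U. -/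
open MeasureTheory

/-- A strictly increasing function between real lines is a measurable embedding. -/
theorem StrictMono.measurableEmbedding_real {h : ℝ → ℝ} (hh : StrictMono h) :
    MeasurableEmbedding h :=
  hh.monotone.measurable.measurableEmbedding hh.injective

/-- Relabelling by a measurable embedding does not change the generated `σ`-algebra. -/
theorem MeasurableEmbedding.comap_comp_eq {Ω α β : Type*} [mα : MeasurableSpace α]
    [mβ : MeasurableSpace β] {f : α → β} (hf : MeasurableEmbedding f) (U : Ω → α) :
    MeasurableSpace.comap (fun ω => f (U ω)) mβ = MeasurableSpace.comap U mα := by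
  rw [← hf.comap_eq, MeasurableSpace.comap_comp]
  rfl

/-- The rank-calibration error is invariant under a strictly increasing relabelling. -/
theorem integral_abs_rank_sub_map_strictMono (ν : Measure ℝ) {reg regh h : ℝ → ℝ}
    (hh : StrictMono h) (hcomp : ∀ u, regh (h u) = reg u) :
    ∫ v, |((ν.map h) {v' | regh v ≤ regh v'}).toReal - ((ν.map h) (Set.Iic v)).toReal| ∂(ν.map h)
      = ∫ u, |(ν {u' | reg u ≤ reg u'}).toReal - (ν (Set.Iic u)).toReal| ∂ν := by
  have hemb := hh.measurableEmbedding_real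
  rw [hemb.integral_map]
  have hsup (u : ℝ) : h ⁻¹' {v' | reg u ≤ regh v'} = {u' | reg u ≤ reg u'} := by
    ext; simp [hcomp]
  have hIic (u : ℝ) : h ⁻¹' Set.Iic (h u) = Set.Iic u := by
    ext; simp [hh.le_iff_le]
  simp only [hemb.map_apply, hcomp, hsup, hIic]

/-- If `reg` is a regression function for `(A, U)`, `h : ℝ → ℝ` is strictly
increasing, and `reg_h` is Borel measurable with `reg_h (h u) = reg u` for all `u`, then `reg_h`
is a regression function for `(A, h ∘ U)`, the RCE of `h ∘ U` computed with `reg_h` equals the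
RCE of `U` computed with `reg`, and in particular rank-calibration of `U` transfers to `h ∘ U`. -/
theorem stmt14 {Ω : Type*} [MeasurableSpace Ω] (P : Measure Ω) [IsProbabilityMeasure P]
    (A U : Ω → ℝ) (hA : Measurable A) (hAbin : ∀ ω, A ω = 0 ∨ A ω = 1)
    (hU : Measurable U) (reg : ℝ → ℝ) (hreg : Measurable reg)
    (hver : (fun ω => reg (U ω)) =ᵐ[P] P[A|MeasurableSpace.comap U inferInstance])
    (h : ℝ → ℝ) (hh : StrictMono h)
    (regh : ℝ → ℝ) (hregh : Measurable regh) (hcomp : ∀ u, regh (h u) = reg u) :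
    ((fun ω => regh (h (U ω)))
        =ᵐ[P] P[A|MeasurableSpace.comap (fun ω => h (U ω)) inferInstance]) ∧
    (∫ v, |((P.map (fun ω => h (U ω))) {v' | regh v ≤ regh v'}).toReal
        - ((P.map (fun ω => h (U ω))) (Set.Iic v)).toReal| ∂(P.map (fun ω => h (U ω)))
      = ∫ u, |((P.map U) {u' | reg u ≤ reg u'}).toReal
        - ((P.map U) (Set.Iic u)).toReal| ∂(P.map U)) ∧
    ((∫ u, |((P.map U) {u' | reg u ≤ reg u'}).toReal
        - ((P.map U) (Set.Iic u)).toReal| ∂(P.map U) = 0) →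
      ∫ v, |((P.map (fun ω => h (U ω))) {v' | regh v ≤ regh v'}).toReal
        - ((P.map (fun ω => h (U ω))) (Set.Iic v)).toReal| ∂(P.map (fun ω => h (U ω))) = 0) := by
  have hemb := hh.measurableEmbedding_real
  have hmap : P.map (fun ω => h (U ω)) = (P.map U).map h :=
    (Measure.map_map hemb.measurable hU).symm
  have hrce := integral_abs_rank_sub_map_strictMono (P.map U) hh hcomp
  rw [hmap]
  refine ⟨?_, hrce, fun h0 => hrce.trans h0⟩
  simp only [hcomp]
  rw [hemb.comap_comp_eq U]
  exact hver
end
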